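/- Let 0 < α < 1. There exists a constant c > 0 such that for every f ∈ Λ_α(ℝ) and all bounded self-adjoint operators A and B on a separable Hilbert space with A − B ∈ S_1, the operator f(A) − f(B) belongs to the weak Schatten class S_{1/α,∞} and ‖f(A) − f(B)‖_{S_{1/α,∞}} ≤ c · ‖f‖_{Λ_α(ℝ)} · ‖A − B‖_{S_1}^α. -/

import Mathlib

open scoped BigOperators
noncomputable section

/-- The `j`-th singular value of a bounded operator `T` on a Hilbert space:
`s_j(T) = inf {‖T - R‖ : rank R ≤ j}`. -/
def sVal {H : Type} [NormedAddCommGroup H] [InnerProductSpace ℂ H] [CompleteSpace H]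
    (T : H →L[ℂ] H) (j : ℕ) : ℝ :=
  sInf {c : ℝ | ∃ R : H →L[ℂ] H, LinearMap.rank (R : H →ₗ[ℂ] H) ≤ (j : Cardinal) ∧ c = ‖T - R‖}

/-- Membership in the Schatten–von Neumann class `S_p`. -/
def MemSchatten {H : Type} [NormedAddCommGroup H] [InnerProductSpace ℂ H] [CompleteSpace H]
    (p : ℝ) (T : H →L[ℂ] H) : Prop :=
  Summable fun j : ℕ => sVal T j ^ p

/-- The Schatten–von Neumann norm `‖T‖_{S_p} = (∑_{j ≥ 0} s_j(T)^p)^{1/p}`. -/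
def schNorm {H : Type} [NormedAddCommGroup H] [InnerProductSpace ℂ H] [CompleteSpace H]
    (p : ℝ) (T : H →L[ℂ] H) : ℝ :=
  (∑' j : ℕ, sVal T j ^ p) ^ (1 / p)

/-- Membership in the weak Schatten class `S_{p,∞}`:  `sup_j (1+j) s_j(T)^p < ∞`. -/
def MemWeakSchatten {H : Type} [NormedAddCommGroup H] [InnerProductSpace ℂ H] [CompleteSpace H]
    (p : ℝ) (T : H →L[ℂ] H) : Prop :=
  ∃ C : ℝ, ∀ j : ℕ, (1 + (j : ℝ)) * sVal T j ^ p ≤ C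

/-- The weak Schatten quasinorm `‖T‖_{S_{p,∞}} = (sup_{j ≥ 0} (1+j) s_j(T)^p)^{1/p}`. -/
def wkNorm {H : Type} [NormedAddCommGroup H] [InnerProductSpace ℂ H] [CompleteSpace H]
    (p : ℝ) (T : H →L[ℂ] H) : ℝ :=
  (⨆ j : ℕ, (1 + (j : ℝ)) * sVal T j ^ p) ^ (1 / p)

/-- `f` satisfies the Hölder condition of order `α` with constant `C`. -/
def HoelderWith (C α : ℝ) (f : ℝ → ℂ) : Prop :=
  ∀ x y : ℝ, ‖f x - f y‖ ≤ C * |x - y| ^ α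

/-- The Hölder norm `‖f‖_{Λ_α(ℝ)} = sup_{x ≠ y} |f(x) - f(y)|/|x - y|^α`, realized as the least
admissible Hölder constant. -/
def hoelderNorm (α : ℝ) (f : ℝ → ℂ) : ℝ :=
  sInf {C : ℝ | 0 ≤ C ∧ HoelderWith C α f}

/-- Membership in the Hölder class `Λ_α(ℝ)`. -/
def MemHoelder (α : ℝ) (f : ℝ → ℂ) : Prop := ∃ C : ℝ, 0 ≤ C ∧ HoelderWith C α f

/-- `f(A)` for a bounded self-adjoint operator `A` (whose spectrum is real), via the continuous
functional calculus. -/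
def opFun {H : Type} [NormedAddCommGroup H] [InnerProductSpace ℂ H] [CompleteSpace H]
    (f : ℝ → ℂ) (A : H →L[ℂ] H) : H →L[ℂ] H :=
  cfc (fun z : ℂ => f z.re) A

section SingularValues

open Module

variable {H : Type} [NormedAddCommGroup H] [InnerProductSpace ℂ H]

/-- The trace norm of `T` is at most `M`, expressed by duality: the diagonal of `T` with respect
to any two finite orthonormal systems has `ℓ¹` norm at most `M`. -/
def TraceBound (T : H →L[ℂ] H) (M : ℝ) : Prop :=
  ∀ (n : ℕ) (x y : Fin n → H), Orthonormal ℂ x → Orthonormal ℂ y →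
    ∑ i, ‖inner ℂ (y i) (T (x i))‖ ≤ M

lemma TraceBound.nonneg {T : H →L[ℂ] H} {M : ℝ} (h : TraceBound T M) : 0 ≤ M := by
  simpa using h 0 ![] ![] (by simp [Orthonormal]) (by simp [Orthonormal])

lemma TraceBound.mono {T : H →L[ℂ] H} {M N : ℝ} (h : TraceBound T M) (hMN : M ≤ N) :
    TraceBound T N := fun n x y hx hy => (h n x y hx hy).trans hMN

lemma TraceBound.add {T S : H →L[ℂ] H} {M N : ℝ} (hT : TraceBound T M) (hS : TraceBound S N) :
    TraceBound (T + S) (M + N) := fun n x y hx hy => by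
  refine le_trans ?_ (add_le_add (hT n x y hx hy) (hS n x y hx hy))
  rw [← Finset.sum_add_distrib]
  refine Finset.sum_le_sum fun i _ => ?_
  rw [add_apply, inner_add_right]
  exact norm_add_le _ _

lemma TraceBound.of_tendsto {T : H →L[ℂ] H} {M : ℕ → ℝ} {M' : ℝ} (h : ∀ N, TraceBound T (M N))
    (hM : Filter.Tendsto M Filter.atTop (nhds M')) : TraceBound T M' :=
  fun n x y hx hy => ge_of_tendsto' hM fun N => h N n x y hx hy

lemma rank_starProjection_span_range_le {n : ℕ} (z : Fin n → H)
    [(Submodule.span ℂ (Set.range z)).HasOrthogonalProjection] :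
    LinearMap.rank ((Submodule.span ℂ (Set.range z)).starProjection : H →ₗ[ℂ] H) ≤
      (n : Cardinal) := by
  rw [LinearMap.rank, Submodule.range_starProjection]
  simpa using (rank_span_le (Set.range z)).trans Cardinal.mk_range_le

variable [CompleteSpace H]

lemma sVal_le_norm_sub (T : H →L[ℂ] H) {j : ℕ} {R : H →L[ℂ] H}
    (hR : LinearMap.rank (R : H →ₗ[ℂ] H) ≤ (j : Cardinal)) : sVal T j ≤ ‖T - R‖ :=
  csInf_le ⟨0, by rintro c ⟨R, -, rfl⟩; exact norm_nonneg _⟩ ⟨R, hR, rfl⟩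

lemma le_sVal {T : H →L[ℂ] H} {j : ℕ} {c : ℝ}
    (h : ∀ R : H →L[ℂ] H, LinearMap.rank (R : H →ₗ[ℂ] H) ≤ (j : Cardinal) → c ≤ ‖T - R‖) :
    c ≤ sVal T j :=
  le_csInf ⟨_, 0, by simp, rfl⟩ (by rintro _ ⟨R, hR, rfl⟩; exact h R hR)

lemma sVal_nonneg (T : H →L[ℂ] H) (j : ℕ) : 0 ≤ sVal T j :=
  le_sVal fun _ _ => norm_nonneg _

lemma exists_norm_sub_lt (T : H →L[ℂ] H) (j : ℕ) {ε : ℝ} (hε : 0 < ε) :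
    ∃ R : H →L[ℂ] H, LinearMap.rank (R : H →ₗ[ℂ] H) ≤ (j : Cardinal) ∧
      ‖T - R‖ < sVal T j + ε := by
  by_contra! h
  linarith [le_sVal h]

lemma sVal_antitone (T : H →L[ℂ] H) : Antitone (sVal T) := fun _ _ hij =>
  le_sVal fun _ hR => sVal_le_norm_sub T (hR.trans (by exact_mod_cast hij))

lemma sVal_le_add_norm_sub (T S : H →L[ℂ] H) (j : ℕ) : sVal T j ≤ sVal S j + ‖T - S‖ := by
  rw [← sub_le_iff_le_add]
  refine le_sVal fun R hR => ?_
  have h1 := sVal_le_norm_sub T hR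
  have h2 := norm_sub_le_norm_sub_add_norm_sub T S R
  linarith

lemma exists_orthogonal_pair (T : H →L[ℂ] H) {j n : ℕ} (hn : n ≤ j) {c : ℝ} (hc : 0 ≤ c)
    (hcT : c < sVal T (2 * j)) (x y : Fin n → H) :
    ∃ a b : H, ‖a‖ = 1 ∧ ‖b‖ = 1 ∧ (∀ i, inner ℂ a (x i) = 0) ∧ (∀ i, inner ℂ b (y i) = 0) ∧
      c < ‖inner ℂ b (T a)‖ := by
  set V := Submodule.span ℂ (Set.range x) with hV
  set W := Submodule.span ℂ (Set.range y) with hW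
  have hfin (z : Fin n → H) : FiniteDimensional ℂ (Submodule.span ℂ (Set.range z)) :=
    FiniteDimensional.span_of_finite ℂ (Set.finite_range z)
  have : FiniteDimensional ℂ V := hfin x
  have : FiniteDimensional ℂ W := hfin y
  set R : H →L[ℂ] H := W.starProjection * T +
    (1 - W.starProjection) * T * V.starProjection with hR
  have hRr : LinearMap.rank (R : H →ₗ[ℂ] H) ≤ ((2 * j : ℕ) : Cardinal) := by
    have h1 : LinearMap.rank (R : H →ₗ[ℂ] H) ≤ (n : Cardinal) + n := by
      refine (LinearMap.rank_add_le _ _).trans (add_le_add ?_ ?_)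
      · exact (LinearMap.rank_comp_le_left (T : H →ₗ[ℂ] H)
          (W.starProjection : H →ₗ[ℂ] H)).trans (rank_starProjection_span_range_le y)
      · exact (LinearMap.rank_comp_le_right (V.starProjection : H →ₗ[ℂ] H)
          (((1 - W.starProjection) * T : H →L[ℂ] H) : H →ₗ[ℂ] H)).trans
            (rank_starProjection_span_range_le x)
    refine h1.trans ?_
    have : n + n ≤ 2 * j := by omega
    exact_mod_cast this
  have hlt : c < ‖T - R‖ := hcT.trans_le (sVal_le_norm_sub T hRr)
  obtain ⟨z, hz⟩ : ∃ z, c * ‖z‖ < ‖(T - R) z‖ := by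
    by_contra! h
    exact absurd (ContinuousLinearMap.opNorm_le_bound _ hc h) (not_le.2 hlt)
  set a := z - V.starProjection z with ha
  set w := T a - W.starProjection (T a) with hw
  have hTw : (T - R) z = w := by
    simp only [hR, hw, ha, sub_apply, add_apply,
      mul_apply_eq_comp, one_apply_eq_self, map_sub]
    abel
  rw [hTw] at hz
  have haV : a ∈ Vᗮ := Submodule.sub_starProjection_mem_orthogonal z
  have hwW : w ∈ Wᗮ := Submodule.sub_starProjection_mem_orthogonal (T a)
  have hwpos : 0 < ‖w‖ := lt_of_le_of_lt (by positivity) hz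
  have ha0 : a ≠ 0 := by
    intro h
    rw [hw, h] at hwpos
    simp at hwpos
  have hapos : 0 < ‖a‖ := norm_pos_iff.2 ha0
  have haz : ‖a‖ ≤ ‖z‖ := by
    have h1 : a = Vᗮ.starProjection z := by
      rw [ha, Submodule.starProjection_orthogonal]; rfl
    rw [h1]
    exact Vᗮ.norm_starProjection_apply_le z
  have hinner : inner ℂ w (T a) = ((‖w‖ ^ 2 : ℝ) : ℂ) := by
    have h1 : T a = w + W.starProjection (T a) := by rw [hw]; abel
    have h2 : inner ℂ w (W.starProjection (T a)) = 0 :=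
      Submodule.inner_left_of_mem_orthogonal (Submodule.starProjection_apply_mem _ _) hwW
    rw [h1, inner_add_right, h2, add_zero, inner_self_eq_norm_sq_to_K]
    norm_cast
  refine ⟨((‖a‖⁻¹ : ℝ) : ℂ) • a, ((‖w‖⁻¹ : ℝ) : ℂ) • w, ?_, ?_, ?_, ?_, ?_⟩
  · rw [norm_smul, Complex.norm_real, norm_inv, norm_norm, inv_mul_cancel₀ hapos.ne']
  · rw [norm_smul, Complex.norm_real, norm_inv, norm_norm, inv_mul_cancel₀ hwpos.ne']
  · intro i
    rw [inner_smul_left, Submodule.inner_left_of_mem_orthogonal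
      (Submodule.subset_span (Set.mem_range_self i)) haV, mul_zero]
  · intro i
    rw [inner_smul_left, Submodule.inner_left_of_mem_orthogonal
      (Submodule.subset_span (Set.mem_range_self i)) hwW, mul_zero]
  · rw [map_smul, inner_smul_left, inner_smul_right, hinner]
    simp only [norm_mul, Complex.norm_real, Complex.conj_ofReal, norm_inv, norm_norm, norm_pow]
    rw [show ‖w‖⁻¹ * (‖a‖⁻¹ * ‖w‖ ^ 2) = ‖w‖ / ‖a‖ by field_simp, lt_div_iff₀ hapos]
    exact (mul_le_mul_of_nonneg_left haz hc).trans_lt hz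

lemma exists_orthonormal_lt_norm_inner (T : H →L[ℂ] H) {j : ℕ} {c : ℝ} (hc : 0 ≤ c)
    (hcT : c < sVal T (2 * j)) {n : ℕ} (hn : n ≤ j + 1) :
    ∃ x y : Fin n → H, Orthonormal ℂ x ∧ Orthonormal ℂ y ∧
      ∀ i, c < ‖inner ℂ (y i) (T (x i))‖ := by
  induction n with
  | zero => exact ⟨![], ![], by simp [Orthonormal], by simp [Orthonormal], fun i => i.elim0⟩
  | succ n ih =>
    obtain ⟨x, y, hx, hy, hxy⟩ := ih (by omega)
    obtain ⟨a, b, ha, hb, hax, hby, hab⟩ :=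
      exists_orthogonal_pair T (by omega : n ≤ j) hc hcT x y
    refine ⟨Matrix.vecCons a x, Matrix.vecCons b y, orthonormal_vecCons_iff.2 ⟨ha, hax, hx⟩,
      orthonormal_vecCons_iff.2 ⟨hb, hby, hy⟩, fun i => ?_⟩
    refine Fin.cases ?_ (fun i => ?_) i
    · simpa using hab
    · simpa using hxy i

lemma TraceBound.mul_sVal_le {T : H →L[ℂ] H} {M : ℝ} (h : TraceBound T M) (j : ℕ) :
    (j + 1) * sVal T (2 * j) ≤ M := by
  by_contra! hlt
  have hj : (0 : ℝ) < j + 1 := by positivity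
  have hM : M / (j + 1) < sVal T (2 * j) := by
    rw [div_lt_iff₀ hj]; linarith
  obtain ⟨x, y, hx, hy, hxy⟩ :=
    exists_orthonormal_lt_norm_inner T (div_nonneg h.nonneg hj.le) hM le_rfl
  have h1 : ∑ _i : Fin (j + 1), M / (j + 1) < ∑ i, ‖inner ℂ (y i) (T (x i))‖ :=
    Finset.sum_lt_sum_of_nonempty Finset.univ_nonempty fun i _ => hxy i
  have h2 := h _ x y hx hy
  simp only [Finset.sum_const, Finset.card_univ, Fintype.card_fin, nsmul_eq_mul] at h1
  push_cast at h1
  rw [mul_div_cancel₀ _ hj.ne'] at h1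
  linarith

lemma TraceBound.sVal_le {T : H →L[ℂ] H} {M : ℝ} (h : TraceBound T M) (j : ℕ) :
    sVal T j ≤ 2 * M / (1 + j) := by
  have h1 := h.mul_sVal_le (j / 2)
  have h2 : sVal T j ≤ sVal T (2 * (j / 2)) := sVal_antitone T (by omega)
  have h3 : (1 + j : ℝ) ≤ 2 * ((j / 2 : ℕ) + 1) := by
    have : 1 + j ≤ 2 * (j / 2 + 1) := by omega
    exact_mod_cast this
  rw [le_div_iff₀ (by positivity)]
  nlinarith [sVal_nonneg T j, sVal_nonneg T (2 * (j / 2)),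
    mul_le_mul h2 h3 (by positivity) (sVal_nonneg T (2 * (j / 2)))]

end SingularValues

section Nuclear

open Module

variable {H : Type} [NormedAddCommGroup H] [InnerProductSpace ℂ H]

/-- `T` is a finite sum of rank one operators of total nuclear norm at most `M`. -/
def NuclearBound (T : H →L[ℂ] H) (M : ℝ) : Prop :=
  ∃ (ι : Type) (_ : Fintype ι) (u v : ι → H),
    T = ∑ k, InnerProductSpace.rankOne ℂ (u k) (v k) ∧ ∑ k, (‖u k‖ ^ 2 + ‖v k‖ ^ 2) ≤ 2 * M

lemma nuclearBound_zero : NuclearBound (0 : H →L[ℂ] H) 0 :=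
  ⟨Empty, inferInstance, Empty.elim, Empty.elim, by simp, by simp⟩

lemma NuclearBound.mono {T : H →L[ℂ] H} {M N : ℝ} (h : NuclearBound T M) (hMN : M ≤ N) :
    NuclearBound T N := by
  obtain ⟨ι, hι, u, v, hT, hM⟩ := h
  exact ⟨ι, hι, u, v, hT, by linarith⟩

lemma NuclearBound.add {T S : H →L[ℂ] H} {M N : ℝ} (hT : NuclearBound T M)
    (hS : NuclearBound S N) : NuclearBound (T + S) (M + N) := by
  obtain ⟨ι, hι, u, v, rfl, hM⟩ := hT
  obtain ⟨κ, hκ, u', v', rfl, hN⟩ := hS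
  refine ⟨ι ⊕ κ, inferInstance, Sum.elim u u', Sum.elim v v', by simp, ?_⟩
  simp only [Fintype.sum_sum_type, Sum.elim_inl, Sum.elim_inr]
  linarith

lemma NuclearBound.sum {T : ℕ → H →L[ℂ] H} {M : ℕ → ℝ} (h : ∀ j, NuclearBound (T j) (M j))
    (N : ℕ) : NuclearBound (∑ j ∈ Finset.range N, T j) (∑ j ∈ Finset.range N, M j) := by
  induction N with
  | zero => simpa using nuclearBound_zero
  | succ N ih =>
    rw [Finset.sum_range_succ, Finset.sum_range_succ]
    exact ih.add (h N)

variable [CompleteSpace H]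

lemma NuclearBound.of_rank_le {T : H →L[ℂ] H} {r : ℕ} {m : ℝ}
    (hr : LinearMap.rank (T : H →ₗ[ℂ] H) ≤ (r : Cardinal)) (hm : 0 < m) (hT : ‖T‖ ≤ m) :
    NuclearBound T (r * m) := by
  set V := LinearMap.range (T : H →ₗ[ℂ] H) with hV
  have hfin : FiniteDimensional ℂ V :=
    Module.rank_lt_aleph0_iff.1 (lt_of_le_of_lt hr Cardinal.natCast_lt_aleph0)
  have hd : finrank ℂ V ≤ r := by
    have h1 : (finrank ℂ V : Cardinal) ≤ r := by
      rw [finrank_eq_rank]; exact hr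
    exact_mod_cast h1
  set b := stdOrthonormalBasis ℂ V with hb
  set s : ℝ := √m with hs
  have hs0 : 0 < s := Real.sqrt_pos.2 hm
  have hs2 : s ^ 2 = m := Real.sq_sqrt hm.le
  refine ⟨Fin (finrank ℂ V), inferInstance, fun i => (s : ℂ) • (b i : H),
    fun i => ((s⁻¹ : ℝ) : ℂ) • ContinuousLinearMap.adjoint T (b i : H), ?_, ?_⟩
  · ext x
    have h1 := congrArg (Subtype.val) (b.sum_repr' ⟨T x, LinearMap.mem_range_self _ x⟩)
    simp only [Submodule.coe_sum, Submodule.coe_smul, Submodule.coe_inner] at h1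
    rw [← h1]
    simp only [sum_apply, InnerProductSpace.rankOne_apply, inner_smul_left,
      ContinuousLinearMap.adjoint_inner_left, Complex.conj_ofReal, smul_smul]
    refine Finset.sum_congr rfl fun i _ => ?_
    congr 1
    have : (s : ℂ) ≠ 0 := by exact_mod_cast hs0.ne'
    push_cast
    field_simp
  · have hterm : ∀ i : Fin (finrank ℂ V), ‖(s : ℂ) • (b i : H)‖ ^ 2 +
        ‖((s⁻¹ : ℝ) : ℂ) • ContinuousLinearMap.adjoint T (b i : H)‖ ^ 2 ≤ 2 * m := by
      intro i
      have hbi : ‖(b i : H)‖ = 1 := b.orthonormal.1 i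
      have h2 : ‖ContinuousLinearMap.adjoint T (b i : H)‖ ≤ m := by
        refine (ContinuousLinearMap.le_opNorm _ _).trans ?_
        rw [hbi, mul_one, LinearIsometryEquiv.norm_map]
        exact hT
      have h3 : ‖ContinuousLinearMap.adjoint T (b i : H)‖ ^ 2 ≤ m ^ 2 := by gcongr
      rw [norm_smul, norm_smul, Complex.norm_real, Complex.norm_real, hbi, mul_one, mul_pow,
        norm_inv, inv_pow, Real.norm_eq_abs, sq_abs, hs2]
      have h4 : m⁻¹ * ‖ContinuousLinearMap.adjoint T (b i : H)‖ ^ 2 ≤ m := by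
        rw [inv_mul_le_iff₀ hm]; nlinarith
      linarith
    refine (Finset.sum_le_sum fun i _ => hterm i).trans ?_
    simp only [Finset.sum_const, Finset.card_univ, Fintype.card_fin, nsmul_eq_mul]
    have : (finrank ℂ V : ℝ) ≤ r := by exact_mod_cast hd
    nlinarith

lemma sum_two_pow_mul_sVal_le {K : H →L[ℂ] H} (hK : Summable (sVal K)) (N : ℕ) :
    ∑ j ∈ Finset.range N, 2 ^ j * sVal K (2 ^ j - 1) ≤ 2 * ∑' j, sVal K j := by
  have h1 := Finset.sum_condensed_le (f := fun k => sVal K (k - 1))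
    (fun m n _ hmn => sVal_antitone K (Nat.sub_le_sub_right hmn 1)) N
  have h2 : ∑ k ∈ Finset.Ico 2 (2 ^ N + 1), sVal K (k - 1) =
      ∑ k ∈ Finset.Ico 1 (2 ^ N), sVal K k := by
    rw [← Finset.sum_Ico_add' (fun k => sVal K (k - 1)) 1 (2 ^ N) 1]
    simp
  have h3 : sVal K 0 + ∑ k ∈ Finset.Ico 1 (2 ^ N), sVal K k ≤ ∑' j, sVal K j := by
    rw [← Finset.sum_range_eq_add_Ico _ (by positivity)]
    exact hK.sum_le_tsum _ fun i _ => sVal_nonneg K i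
  have h4 : ∑ j ∈ Finset.range N, 2 ^ j * sVal K (2 ^ j - 1) ≤
      ∑ j ∈ Finset.range (N + 1), 2 ^ j * sVal K (2 ^ j - 1) := by
    rw [Finset.sum_range_succ]
    have := sVal_nonneg K (2 ^ N - 1)
    exact le_add_of_nonneg_right (by positivity)
  simp only [nsmul_eq_mul, Nat.cast_pow, Nat.cast_ofNat, h2] at h1
  have h5 := sVal_nonneg K 0
  norm_num at h1
  linarith

/-- A trace class operator is approximated by finite sums of rank one operators whose nuclear
norms are controlled by the trace norm. -/
lemma exists_nuclearBound_norm_sub_le {K : H →L[ℂ] H} (hK : Summable (sVal K)) {ε : ℝ}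
    (hε : 0 < ε) :
    ∃ K' : H →L[ℂ] H, NuclearBound K' (12 * (∑' j, sVal K j) + ε) ∧ ‖K - K'‖ ≤ ε := by
  set η : ℕ → ℝ := fun j => ε / 12 * (1 / 4) ^ j with hη
  have hη0 : ∀ j, 0 < η j := fun j => by positivity
  choose R hRr hRn using fun j : ℕ => exists_norm_sub_lt K (2 ^ j - 1) (hη0 j)
  have hR0 : R 0 = 0 := by
    have h := hRr 0
    simp only [pow_zero, le_refl, Nat.sub_eq_zero_of_le, Nat.cast_zero, nonpos_iff_eq_zero,
      LinearMap.rank, Submodule.rank_eq_zero,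
      LinearMap.range_eq_bot] at h
    exact ContinuousLinearMap.coe_injective (by simpa using h)
  have hD : ∀ j, NuclearBound (R (j + 1) - R j)
      (6 * (2 ^ j * sVal K (2 ^ j - 1)) + ε / 2 * (1 / 2) ^ j) := by
    intro j
    have hrank : LinearMap.rank ((R (j + 1) - R j : H →L[ℂ] H) : H →ₗ[ℂ] H) ≤
        ((3 * 2 ^ j : ℕ) : Cardinal) := by
      have h1 : LinearMap.rank ((R (j + 1) - R j : H →L[ℂ] H) : H →ₗ[ℂ] H) ≤
          ((2 ^ (j + 1) - 1 : ℕ) : Cardinal) + ((2 ^ j - 1 : ℕ) : Cardinal) := by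
        rw [sub_eq_add_neg]
        refine (LinearMap.rank_add_le _ _).trans (add_le_add (hRr (j + 1)) ?_)
        have : LinearMap.rank ((-R j : H →L[ℂ] H) : H →ₗ[ℂ] H) =
            LinearMap.rank (R j : H →ₗ[ℂ] H) := by
          rw [ContinuousLinearMap.toLinearMap_neg, LinearMap.rank, LinearMap.rank,
            LinearMap.range_neg]
        rw [this]
        exact hRr j
      refine h1.trans ?_
      have : 2 ^ (j + 1) - 1 + (2 ^ j - 1) ≤ 3 * 2 ^ j := by
        rw [pow_succ]; omega
      exact_mod_cast this
    have hnorm : ‖R (j + 1) - R j‖ ≤ 2 * (sVal K (2 ^ j - 1) + η j) := by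
      have h1 : ‖R (j + 1) - R j‖ ≤ ‖K - R (j + 1)‖ + ‖K - R j‖ := by
        rw [norm_sub_rev K (R (j + 1))]
        exact norm_sub_le_norm_sub_add_norm_sub _ _ _
      have h2 : sVal K (2 ^ (j + 1) - 1) ≤ sVal K (2 ^ j - 1) :=
        sVal_antitone K (Nat.sub_le_sub_right (Nat.pow_le_pow_right two_pos (Nat.le_succ j)) 1)
      have h3 : η (j + 1) ≤ η j := by
        simp only [hη, pow_succ]
        have : 0 < ε / 12 * (1 / 4 : ℝ) ^ j := by positivity
        linarith
      linarith [hRn j, hRn (j + 1)]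
    have hpos : 0 < 2 * (sVal K (2 ^ j - 1) + η j) := by
      have := sVal_nonneg K (2 ^ j - 1)
      have := hη0 j
      positivity
    refine (NuclearBound.of_rank_le hrank hpos hnorm).mono (le_of_eq ?_)
    have h4 : (2 : ℝ) ^ j * (1 / 4) ^ j = (1 / 2) ^ j := by
      rw [← mul_pow]; norm_num
    rw [← h4]
    simp only [hη]
    push_cast
    ring
  have hlim : Filter.Tendsto (fun j : ℕ => sVal K (2 ^ j - 1) + η j) Filter.atTop (nhds 0) := by
    have h1 : Filter.Tendsto (fun j : ℕ => 2 ^ j - 1) Filter.atTop Filter.atTop :=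
      (Filter.tendsto_sub_atTop_nat 1).comp (tendsto_pow_atTop_atTop_of_one_lt one_lt_two)
    have h2 : Filter.Tendsto η Filter.atTop (nhds (ε / 12 * 0)) :=
      (tendsto_pow_atTop_nhds_zero_of_lt_one (by norm_num) (by norm_num)).const_mul _
    simpa using (hK.tendsto_atTop_zero.comp h1).add h2
  obtain ⟨N, hN⟩ := (hlim.eventually_lt_const hε).exists
  refine ⟨R N, ?_, (hRn N).le.trans hN.le⟩
  have htel : R N = ∑ j ∈ Finset.range N, (R (j + 1) - R j) := by
    rw [Finset.sum_range_sub, hR0, sub_zero]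
  rw [htel]
  refine (NuclearBound.sum hD N).mono ?_
  rw [Finset.sum_add_distrib, ← Finset.mul_sum, ← Finset.mul_sum]
  have h5 : ∑ j ∈ Finset.range N, (1 / 2 : ℝ) ^ j ≤ 2 := sum_geometric_two_le N
  nlinarith [sum_two_pow_mul_sVal_le hK N]

end Nuclear

section PoissonMean

open MeasureTheory Real

lemma HoelderWith.nonneg {C α : ℝ} {f : ℝ → ℂ} (hC : HoelderWith C α f) : 0 ≤ C := by
  simpa using (norm_nonneg _).trans (hC 0 1)

lemma HoelderWith.continuous {C α : ℝ} {f : ℝ → ℂ} (hα : 0 < α) (hf : HoelderWith C α f) :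
    Continuous f := by
  refine continuous_iff_continuousAt.2 fun x => ?_
  rw [ContinuousAt, tendsto_iff_norm_sub_tendsto_zero]
  have h1 : Filter.Tendsto (fun y => C * |y - x| ^ α) (nhds x) (nhds 0) := by
    have h2 : Continuous fun y => C * |y - x| ^ α :=
      continuous_const.mul ((by fun_prop : Continuous fun y : ℝ => |y - x|).rpow_const
        fun _ => Or.inr hα.le)
    simpa [Real.zero_rpow hα.ne'] using h2.tendsto x
  exact squeeze_zero (fun _ => norm_nonneg _) (fun y => hf y x) h1

/-- The density of the standard Cauchy distribution. -/
def cauchyWeight (s : ℝ) : ℝ := π⁻¹ * (1 + s ^ 2)⁻¹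

lemma cauchyWeight_nonneg (s : ℝ) : 0 ≤ cauchyWeight s := by
  unfold cauchyWeight; positivity

lemma continuous_cauchyWeight : Continuous cauchyWeight := by
  unfold cauchyWeight
  exact continuous_const.mul (Continuous.inv₀ (by fun_prop) fun s => by positivity)

lemma integrable_cauchyWeight : Integrable cauchyWeight :=
  integrable_inv_one_add_sq.const_mul _

lemma integral_cauchyWeight : ∫ s, cauchyWeight s = 1 := by
  simp only [cauchyWeight]
  rw [integral_const_mul, integral_univ_inv_one_add_sq, inv_mul_cancel₀ pi_ne_zero]

lemma integrable_cauchyWeight_mul_rpow {α : ℝ} (hα0 : 0 < α) (hα1 : α < 1) :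
    Integrable fun s => cauchyWeight s * |s| ^ α := by
  have h1 : Integrable (fun s : ℝ => 2 * (1 + ‖s‖) ^ (-(2 - α))) :=
    (integrable_one_add_norm (by simp; linarith)).const_mul 2
  refine h1.mono' ?_ (Filter.Eventually.of_forall fun s => ?_)
  · exact (continuous_cauchyWeight.mul
      (continuous_abs.rpow_const fun _ => Or.inr hα0.le)).aestronglyMeasurable
  · rw [norm_of_nonneg (mul_nonneg (cauchyWeight_nonneg s) (by positivity)), cauchyWeight,
      norm_eq_abs, neg_sub, rpow_sub (by positivity), rpow_two]
    have h2 : |s| ^ α ≤ (1 + |s|) ^ α := by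
      gcongr; linarith
    have h3 : π⁻¹ * (1 + s ^ 2)⁻¹ ≤ 2 * ((1 + |s|) ^ 2)⁻¹ := by
      have h4 : π⁻¹ ≤ 1 := inv_le_one_of_one_le₀ (by linarith [pi_gt_three])
      have h5 : (1 + s ^ 2)⁻¹ ≤ 2 * ((1 + |s|) ^ 2)⁻¹ := by
        rw [← div_eq_mul_inv, inv_eq_one_div, div_le_div_iff₀ (by positivity) (by positivity)]
        nlinarith [sq_nonneg (1 - |s|), sq_abs s]
      calc π⁻¹ * (1 + s ^ 2)⁻¹ ≤ 1 * (1 + s ^ 2)⁻¹ := by gcongr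
        _ ≤ _ := by rw [one_mul]; exact h5
    calc π⁻¹ * (1 + s ^ 2)⁻¹ * |s| ^ α ≤ 2 * ((1 + |s|) ^ 2)⁻¹ * (1 + |s|) ^ α := by gcongr
      _ = _ := by ring

/-- The Poisson mean of `f` at scale `δ`. -/
def poissonMean (δ : ℝ) (f : ℝ → ℂ) (x : ℝ) : ℂ := ∫ s, cauchyWeight s • f (x + δ * s)

variable {f : ℝ → ℂ} {m C α : ℝ}

lemma integrable_cauchyWeight_smul {g : ℝ → ℂ} (hg : Continuous g) (hm : ∀ x, ‖g x‖ ≤ m) :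
    Integrable fun s => cauchyWeight s • g s := by
  refine (integrable_cauchyWeight.mul_const m).mono'
    (continuous_cauchyWeight.smul hg).aestronglyMeasurable
    (Filter.Eventually.of_forall fun s => ?_)
  rw [norm_smul, norm_of_nonneg (cauchyWeight_nonneg s)]
  exact mul_le_mul_of_nonneg_left (hm s) (cauchyWeight_nonneg s)

lemma norm_integral_cauchyWeight_smul_le {g : ℝ → ℂ} (hm : ∀ x, ‖g x‖ ≤ m) :
    ‖∫ s, cauchyWeight s • g s‖ ≤ m := by
  refine (norm_integral_le_of_norm_le (integrable_cauchyWeight.mul_const m)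
    (Filter.Eventually.of_forall fun s => ?_)).trans_eq ?_
  · rw [norm_smul, norm_of_nonneg (cauchyWeight_nonneg s)]
    exact mul_le_mul_of_nonneg_left (hm s) (cauchyWeight_nonneg s)
  · rw [integral_mul_const, integral_cauchyWeight, one_mul]

lemma norm_poissonMean_le (δ : ℝ) (hm : ∀ x, ‖f x‖ ≤ m) (x : ℝ) : ‖poissonMean δ f x‖ ≤ m :=
  norm_integral_cauchyWeight_smul_le fun _ => hm _

lemma integrable_poissonMean_integrand (δ x : ℝ) (hf : Continuous f) (hm : ∀ x, ‖f x‖ ≤ m) :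
    Integrable fun s => cauchyWeight s • f (x + δ * s) :=
  integrable_cauchyWeight_smul (by fun_prop) fun _ => hm _

lemma HoelderWith.poissonMean (δ : ℝ) (hf : Continuous f) (hm : ∀ x, ‖f x‖ ≤ m)
    (hC : HoelderWith C α f) : HoelderWith C α (poissonMean δ f) := by
  intro x y
  rw [_root_.poissonMean, _root_.poissonMean,
    ← integral_sub (integrable_poissonMean_integrand δ x hf hm)
      (integrable_poissonMean_integrand δ y hf hm)]
  simp_rw [← smul_sub]
  refine norm_integral_cauchyWeight_smul_le fun s => ?_
  simpa using hC (x + δ * s) (y + δ * s)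

lemma poissonMean_sub {g : ℝ → ℂ} {m' : ℝ} (δ : ℝ) (hf : Continuous f) (hm : ∀ x, ‖f x‖ ≤ m)
    (hg : Continuous g) (hm' : ∀ x, ‖g x‖ ≤ m') (x : ℝ) :
    poissonMean δ (fun y => f y - g y) x = poissonMean δ f x - poissonMean δ g x := by
  rw [poissonMean, poissonMean, poissonMean,
    ← integral_sub (integrable_poissonMean_integrand δ x hf hm)
      (integrable_poissonMean_integrand δ x hg hm')]
  simp_rw [← smul_sub]

lemma norm_sub_poissonMean_le {δ : ℝ} (hδ : 0 < δ) (hα0 : 0 < α) (hα1 : α < 1)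
    (hf : Continuous f) (hm : ∀ x, ‖f x‖ ≤ m) (hC : HoelderWith C α f) (x : ℝ) :
    ‖f x - poissonMean δ f x‖ ≤ C * (∫ s, cauchyWeight s * |s| ^ α) * δ ^ α := by
  have h1 : f x = ∫ s, cauchyWeight s • f x := by
    rw [integral_smul_const, integral_cauchyWeight, one_smul]
  have h2 : f x - poissonMean δ f x = ∫ s, cauchyWeight s • (f x - f (x + δ * s)) := by
    simp_rw [smul_sub]
    rw [integral_sub (integrable_cauchyWeight.smul_const _)
      (integrable_poissonMean_integrand δ x hf hm), ← h1, poissonMean]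
  rw [h2]
  refine (norm_integral_le_of_norm_le (((integrable_cauchyWeight_mul_rpow hα0 hα1).const_mul
    C).mul_const (δ ^ α)) (Filter.Eventually.of_forall fun s => ?_)).trans_eq ?_
  · rw [norm_smul, norm_of_nonneg (cauchyWeight_nonneg s)]
    have h3 := hC x (x + δ * s)
    rw [sub_add_cancel_left, abs_neg, abs_mul, abs_of_pos hδ, mul_rpow hδ.le (abs_nonneg s)] at h3
    calc cauchyWeight s * ‖f x - f (x + δ * s)‖
        ≤ cauchyWeight s * (C * (δ ^ α * |s| ^ α)) :=
          mul_le_mul_of_nonneg_left h3 (cauchyWeight_nonneg s)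
      _ = _ := by ring
  · rw [integral_mul_const, integral_const_mul]

lemma poissonMean_comm (a b : ℝ) (hf : Continuous f) (hm : ∀ x, ‖f x‖ ≤ m) (x : ℝ) :
    poissonMean a (poissonMean b f) x = poissonMean b (poissonMean a f) x := by
  simp only [poissonMean, ← integral_smul]
  rw [integral_integral_swap]
  · refine integral_congr_ae (Filter.Eventually.of_forall fun s => ?_)
    refine integral_congr_ae (Filter.Eventually.of_forall fun t => ?_)
    simp only
    rw [smul_comm, show x + a * t + b * s = x + b * s + a * t by ring]
  · refine ((integrable_cauchyWeight.mul_prod integrable_cauchyWeight).mul_const m).mono' ?_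
      (Filter.Eventually.of_forall fun z => ?_)
    · refine Continuous.aestronglyMeasurable ?_
      have := continuous_cauchyWeight
      simp only [Function.uncurry_def]
      fun_prop
    · simp only [Function.uncurry_def]
      rw [norm_smul, norm_smul, norm_of_nonneg (cauchyWeight_nonneg _),
        norm_of_nonneg (cauchyWeight_nonneg _), ← mul_assoc]
      exact mul_le_mul_of_nonneg_left (hm _)
        (mul_nonneg (cauchyWeight_nonneg _) (cauchyWeight_nonneg _))

lemma poissonMean_eq_integral {δ : ℝ} (hδ : 0 < δ) (f : ℝ → ℂ) (x : ℝ) :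
    poissonMean δ f x = ∫ t, (δ / π * ((x - t) ^ 2 + δ ^ 2)⁻¹) • f t := by
  have h1 := Measure.integral_comp_mul_left
    (fun t => (δ / π * (t ^ 2 + δ ^ 2)⁻¹) • f (x + t)) δ
  have h2 := integral_add_left_eq_self (μ := volume)
    (fun t => (δ / π * ((x - t) ^ 2 + δ ^ 2)⁻¹) • f t) x
  rw [← h2]
  simp only [sub_add_cancel_left, neg_sq]
  have h3 : ∫ t, (δ / π * (t ^ 2 + δ ^ 2)⁻¹) • f (x + t) =
      δ • ∫ s, (δ / π * ((δ * s) ^ 2 + δ ^ 2)⁻¹) • f (x + δ * s) := by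
    rw [h1, smul_smul, abs_of_pos (inv_pos.2 hδ), mul_inv_cancel₀ hδ.ne', one_smul]
  rw [h3, ← integral_smul, poissonMean]
  refine integral_congr_ae (Filter.Eventually.of_forall fun s => ?_)
  simp only [smul_smul, cauchyWeight]
  congr 1
  have : 1 + s ^ 2 ≠ 0 := by positivity
  rw [show (δ * s) ^ 2 + δ ^ 2 = δ ^ 2 * (1 + s ^ 2) by ring]
  field_simp

end PoissonMean

section FunctionalCalculus

variable {H : Type} [NormedAddCommGroup H] [InnerProductSpace ℂ H] [CompleteSpace H]
  {A B : H →L[ℂ] H} {f g : ℝ → ℂ}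

lemma continuousOn_comp_re (hf : Continuous f) (s : Set ℂ) :
    ContinuousOn (fun z : ℂ => f z.re) s :=
  (hf.comp Complex.continuous_re).continuousOn

lemma opFun_sub (hf : Continuous f) (hg : Continuous g) :
    opFun (fun x => f x - g x) A = opFun f A - opFun g A :=
  cfc_sub (fun z : ℂ => f z.re) (fun z : ℂ => g z.re) A (continuousOn_comp_re hf _)
    (continuousOn_comp_re hg _)

lemma opFun_add (hf : Continuous f) (hg : Continuous g) :
    opFun (fun x => f x + g x) A = opFun f A + opFun g A :=
  cfc_add A (fun z : ℂ => f z.re) (fun z : ℂ => g z.re) (continuousOn_comp_re hf _)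
    (continuousOn_comp_re hg _)

lemma opFun_mul (hf : Continuous f) (hg : Continuous g) :
    opFun (fun x => f x * g x) A = opFun f A * opFun g A :=
  cfc_mul (fun z : ℂ => f z.re) (fun z : ℂ => g z.re) A (continuousOn_comp_re hf _)
    (continuousOn_comp_re hg _)

lemma opFun_const_mul (c : ℂ) (hf : Continuous f) :
    opFun (fun x => c * f x) A = c • opFun f A :=
  cfc_const_mul c (fun z : ℂ => f z.re) A (continuousOn_comp_re hf _)

lemma opFun_const (hA : IsSelfAdjoint A) (c : ℂ) :
    opFun (fun _ => c) A = algebraMap ℂ (H →L[ℂ] H) c :=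
  have := hA.isStarNormal
  cfc_const c A

lemma opFun_id (hA : IsSelfAdjoint A) : opFun (fun x => (x : ℂ)) A = A := by
  have := hA.isStarNormal
  rw [opFun, cfc_congr (g := id) fun z hz => (hA.mem_spectrum_eq_re hz).symm]
  exact cfc_id ℂ A

lemma isSelfAdjoint_opFun (φ : ℝ → ℝ) : IsSelfAdjoint (opFun (fun x => (φ x : ℂ)) A) := by
  rw [isSelfAdjoint_iff, opFun, ← cfc_star]
  simp

lemma exists_abs_re_le_of_mem_spectrum (A : H →L[ℂ] H) :
    ∃ r : ℝ, 0 ≤ r ∧ ∀ z ∈ spectrum ℂ A, |z.re| ≤ r :=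
  ⟨‖A‖ * ‖(1 : H →L[ℂ] H)‖, by positivity, fun z hz =>
    (Complex.abs_re_le_norm z).trans (spectrum.norm_le_norm_mul_of_mem hz)⟩

lemma norm_opFun_le {m : ℝ} (hm0 : 0 ≤ m) (hm : ∀ x, ‖f x‖ ≤ m) : ‖opFun f A‖ ≤ m :=
  norm_cfc_le hm0 fun z _ => hm z.re

end FunctionalCalculus

section Resolvent

open MeasureTheory Real

/-- The squared modulus of the resolvent kernel `1 / (x - t - iδ)`. -/
def resSq (δ t x : ℝ) : ℝ := ((x - t) ^ 2 + δ ^ 2)⁻¹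

/-- The real part of the resolvent kernel `1 / (x - t - iδ)`. -/
def resRe (δ t x : ℝ) : ℝ := (x - t) * resSq δ t x

variable {δ : ℝ}

lemma continuous_resSq_uncurry (hδ : 0 < δ) : Continuous fun p : ℝ × ℝ => resSq δ p.1 p.2 := by
  unfold resSq
  exact Continuous.inv₀ (by fun_prop) fun p => by positivity

lemma continuous_resSq (hδ : 0 < δ) (t : ℝ) : Continuous (resSq δ t) :=
  (continuous_resSq_uncurry hδ).comp (Continuous.prodMk_right t)

lemma continuous_resRe (hδ : 0 < δ) (t : ℝ) : Continuous (resRe δ t) := by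
  have := continuous_resSq hδ t
  unfold resRe
  fun_prop

lemma sub_mul_resRe_add (hδ : 0 < δ) (t x : ℝ) :
    (x - t) * resRe δ t x + δ ^ 2 * resSq δ t x = 1 := by
  have : (x - t) ^ 2 + δ ^ 2 ≠ 0 := by positivity
  unfold resRe resSq
  field_simp

lemma resRe_mul_self_add (hδ : 0 < δ) (t x : ℝ) :
    resRe δ t x * resRe δ t x + δ ^ 2 * (resSq δ t x * resSq δ t x) = resSq δ t x := by
  have := sub_mul_resRe_add hδ t x
  calc _ = ((x - t) * resRe δ t x + δ ^ 2 * resSq δ t x) * resSq δ t x := by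
        unfold resRe; ring
    _ = _ := by rw [this, one_mul]

lemma resSq_le (hδ : 0 < δ) {r x : ℝ} (hr : |x| ≤ r) (t : ℝ) :
    resSq δ t x ≤ (2 + (1 + 2 * r ^ 2) / δ ^ 2) * (1 + t ^ 2)⁻¹ := by
  have h0 : (0 : ℝ) < (x - t) ^ 2 + δ ^ 2 := by positivity
  have h1 : x ^ 2 ≤ r ^ 2 := sq_le_sq' (by linarith [abs_le.1 hr]) (abs_le.1 hr).2
  rw [resSq, inv_eq_one_div, ← div_eq_mul_inv, div_le_div_iff₀ h0 (by positivity)]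
  have h2 : (1 + 2 * r ^ 2) / δ ^ 2 * δ ^ 2 = 1 + 2 * r ^ 2 := by field_simp
  have h3 : 0 ≤ (1 + 2 * r ^ 2) / δ ^ 2 * (x - t) ^ 2 := by positivity
  nlinarith [sq_nonneg (2 * x - t), sq_nonneg δ]

variable {H : Type} [NormedAddCommGroup H] [InnerProductSpace ℂ H] [CompleteSpace H]
  {A B : H →L[ℂ] H} {f : ℝ → ℂ} {m : ℝ}

/-- `opFun` of the real valued function `resSq δ t`. -/
def opResSq (δ t : ℝ) (A : H →L[ℂ] H) : H →L[ℂ] H := opFun (fun x => (resSq δ t x : ℂ)) A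

/-- `opFun` of the real valued function `resRe δ t`. -/
def opResRe (δ t : ℝ) (A : H →L[ℂ] H) : H →L[ℂ] H := opFun (fun x => (resRe δ t x : ℂ)) A

lemma continuous_coe_resSq (hδ : 0 < δ) (t : ℝ) : Continuous fun x => (resSq δ t x : ℂ) :=
  Complex.continuous_ofReal.comp (continuous_resSq hδ t)

lemma continuous_coe_resRe (hδ : 0 < δ) (t : ℝ) : Continuous fun x => (resRe δ t x : ℂ) :=
  Complex.continuous_ofReal.comp (continuous_resRe hδ t)

lemma opResRe_mul_self_add (hδ : 0 < δ) (t : ℝ) :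
    opResRe δ t A * opResRe δ t A + ((δ ^ 2 : ℝ) : ℂ) • (opResSq δ t A * opResSq δ t A) =
      opResSq δ t A := by
  have hS := continuous_coe_resSq hδ t
  have hR := continuous_coe_resRe hδ t
  have hRR : Continuous fun x => (resRe δ t x : ℂ) * (resRe δ t x : ℂ) := hR.mul hR
  have hSS : Continuous fun x => (resSq δ t x : ℂ) * (resSq δ t x : ℂ) := hS.mul hS
  have hcS : Continuous fun x => ((δ ^ 2 : ℝ) : ℂ) * ((resSq δ t x : ℂ) * (resSq δ t x : ℂ)) :=
    continuous_const.mul hSS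
  rw [opResRe, opResSq, ← opFun_mul hR hR, ← opFun_mul hS hS, ← opFun_const_mul _ hSS,
    ← opFun_add hRR hcS]
  congr 1
  ext x
  exact_mod_cast resRe_mul_self_add hδ t x

lemma opResSq_sub_opResSq (hδ : 0 < δ) (t : ℝ) (hA : IsSelfAdjoint A) (hB : IsSelfAdjoint B) :
    opResSq δ t A - opResSq δ t B =
      -(opResRe δ t A * (A - B) * opResSq δ t B + opResSq δ t A * (A - B) * opResRe δ t B) := by
  have hS := continuous_coe_resSq hδ t
  have hR := continuous_coe_resRe hδ t
  have hL : Continuous fun x : ℝ => ((x : ℂ) - (t : ℂ)) := by fun_prop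
  set L : (H →L[ℂ] H) → (H →L[ℂ] H) := fun T => opFun (fun x => (x : ℂ) - (t : ℂ)) T with hLdef
  have hRL : Continuous fun x : ℝ => (resRe δ t x : ℂ) * ((x : ℂ) - (t : ℂ)) := hR.mul hL
  have hLR : Continuous fun x : ℝ => ((x : ℂ) - (t : ℂ)) * (resRe δ t x : ℂ) := hL.mul hR
  have hcS : Continuous fun x => ((δ ^ 2 : ℝ) : ℂ) * (resSq δ t x : ℂ) := continuous_const.mul hS
  have hLsub : A - B = L A - L B := by
    simp only [hLdef]
    rw [opFun_sub Complex.continuous_ofReal continuous_const,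
      opFun_sub Complex.continuous_ofReal continuous_const, opFun_id hA, opFun_id hB,
      opFun_const hA, opFun_const hB]
    abel
  have h1 : opResRe δ t A * L A = 1 - ((δ ^ 2 : ℝ) : ℂ) • opResSq δ t A := by
    rw [eq_sub_iff_add_eq, opResRe, opResSq, ← opFun_mul hR hL, ← opFun_const_mul _ hS,
      ← opFun_add hRL hcS, ← map_one (algebraMap ℂ (H →L[ℂ] H)),
      ← opFun_const hA]
    congr 1
    ext x
    rw [mul_comm (resRe δ t x : ℂ)]
    exact_mod_cast sub_mul_resRe_add hδ t x
  have h2 : L B * opResRe δ t B = 1 - ((δ ^ 2 : ℝ) : ℂ) • opResSq δ t B := by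
    rw [eq_sub_iff_add_eq, opResRe, opResSq, ← opFun_mul hL hR, ← opFun_const_mul _ hS,
      ← opFun_add hLR hcS, ← map_one (algebraMap ℂ (H →L[ℂ] H)),
      ← opFun_const hB]
    congr 1
    ext x
    exact_mod_cast sub_mul_resRe_add hδ t x
  have h3 : opResSq δ t A * L A = opResRe δ t A := by
    rw [opResRe, opResSq, ← opFun_mul hS hL]
    congr 1
    ext x
    simp only [resRe]
    push_cast
    ring
  have h4 : L B * opResSq δ t B = opResRe δ t B := by
    rw [opResRe, opResSq, ← opFun_mul hL hS]
    congr 1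
    ext x
    simp only [resRe]
    push_cast
    ring
  have h5 : opResRe δ t A * (A - B) * opResSq δ t B =
      opResSq δ t B - ((δ ^ 2 : ℝ) : ℂ) • (opResSq δ t A * opResSq δ t B) -
        opResRe δ t A * opResRe δ t B := by
    rw [hLsub, mul_sub, sub_mul, h1, mul_assoc, h4, sub_mul, one_mul, smul_mul_assoc]
  have h6 : opResSq δ t A * (A - B) * opResRe δ t B =
      opResRe δ t A * opResRe δ t B -
        (opResSq δ t A - ((δ ^ 2 : ℝ) : ℂ) • (opResSq δ t A * opResSq δ t B)) := by
    rw [hLsub, mul_sub, sub_mul, h3, mul_assoc, h2, mul_sub, mul_one, mul_smul_comm]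
  rw [h5, h6]
  abel

lemma re_inner_opResSq (hδ : 0 < δ) (t : ℝ) (u : H) :
    RCLike.re (inner ℂ u (opResSq δ t A u)) =
      ‖opResRe δ t A u‖ ^ 2 + δ ^ 2 * ‖opResSq δ t A u‖ ^ 2 := by
  have key : ∀ X : H →L[ℂ] H, IsSelfAdjoint X → inner ℂ u ((X * X) u) = ((‖X u‖ ^ 2 : ℝ) : ℂ) := by
    intro X hX
    have h1 : inner ℂ (X u) (X u) = inner ℂ u (X (X u)) := hX.isSymmetric u (X u)
    rw [mul_apply_eq_comp, ← h1, inner_self_eq_norm_sq_to_K]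
    norm_cast
  have hR : IsSelfAdjoint (opResRe δ t A) := isSelfAdjoint_opFun _
  have hS : IsSelfAdjoint (opResSq δ t A) := isSelfAdjoint_opFun _
  conv_lhs => rw [← opResRe_mul_self_add hδ t, add_apply, smul_apply, inner_add_right,
    inner_smul_right, key _ hR, key _ hS]
  rw [← Complex.ofReal_mul, ← Complex.ofReal_add]
  exact RCLike.ofReal_re (K := ℂ) _

lemma hasFiniteIntegral_resSq_bound (c : ℝ) :
    HasFiniteIntegral (fun t : ℝ => c * (1 + t ^ 2)⁻¹) volume :=
  (integrable_inv_one_add_sq.const_mul c).hasFiniteIntegral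

lemma integrable_and_integral_smul_opResSq (hδ : 0 < δ) (hA : IsSelfAdjoint A)
    (hf : Continuous f) (hm : ∀ x, ‖f x‖ ≤ m) :
    Integrable (fun t => f t • opResSq δ t A) ∧
      opFun (poissonMean δ f) A = ((δ / π : ℝ) : ℂ) • ∫ t, f t • opResSq δ t A := by
  have := hA.isStarNormal
  obtain ⟨r, -, hr⟩ := exists_abs_re_le_of_mem_spectrum A
  have hm0 : 0 ≤ m := (norm_nonneg _).trans (hm 0)
  have hsmul : (fun t => f t • opResSq δ t A) =
      fun t => cfc (fun z : ℂ => f t * (resSq δ t z.re : ℂ)) A := by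
    ext1 t
    exact (opFun_const_mul (f t) (continuous_coe_resSq hδ t)).symm
  have hcont : Continuous (Function.uncurry fun (t : ℝ) (z : ℂ) =>
      f t * (resSq δ t z.re : ℂ)) := by
    have h1 : Continuous fun p : ℝ × ℂ => resSq δ p.1 p.2.re :=
      (continuous_resSq_uncurry hδ).comp
        (continuous_fst.prodMk (Complex.continuous_re.comp continuous_snd))
    simp only [Function.uncurry_def]
    fun_prop
  set c := m * (2 + (1 + 2 * r ^ 2) / δ ^ 2) with hc
  have hbound : ∀ᵐ t : ℝ, ∀ z ∈ spectrum ℂ A, ‖f t * (resSq δ t z.re : ℂ)‖ ≤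
      c * (1 + t ^ 2)⁻¹ := by
    refine Filter.Eventually.of_forall fun t z hz => ?_
    have h0 : 0 ≤ resSq δ t z.re := by unfold resSq; positivity
    rw [norm_mul, Complex.norm_real, norm_of_nonneg h0, hc, mul_assoc]
    exact mul_le_mul (hm t) (resSq_le hδ (hr z hz) t) h0 hm0
  refine ⟨?_, ?_⟩
  · rw [hsmul]
    exact integrable_cfc _ _ A hcont.continuousOn hbound (hasFiniteIntegral_resSq_bound c)
  · have h1 := cfc_integral _ _ A hcont.continuousOn hbound (hasFiniteIntegral_resSq_bound c)
    have h2 : opFun (poissonMean δ f) A =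
        cfc (fun z : ℂ => ((δ / π : ℝ) : ℂ) * ∫ t, f t * (resSq δ t z.re : ℂ)) A := by
      rw [opFun]
      congr 1
      ext z
      rw [poissonMean_eq_integral hδ, ← integral_const_mul]
      refine integral_congr_ae (Filter.Eventually.of_forall fun t => ?_)
      simp only [resSq, Complex.real_smul]
      push_cast
      ring
    have h3 : ContinuousOn (fun z : ℂ => ∫ t, f t * (resSq δ t z.re : ℂ)) (spectrum ℂ A) := by
      refine continuousOn_of_dominated (bound := fun t => c * (1 + t ^ 2)⁻¹) ?_ ?_
        (integrable_inv_one_add_sq.const_mul c) ?_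
      · exact fun z _ => (hcont.comp (Continuous.prodMk_left z)).aestronglyMeasurable
      · intro z hz
        filter_upwards [hbound] with t ht using ht z hz
      · exact Filter.Eventually.of_forall fun t =>
          (hcont.comp (Continuous.prodMk_right t)).continuousOn
    rw [h2, cfc_const_mul _ _ A h3, h1, hsmul]

lemma integrable_and_integral_re_inner_opResSq (hδ : 0 < δ) (hA : IsSelfAdjoint A) (u : H) :
    Integrable (fun t => RCLike.re (inner ℂ u (opResSq δ t A u))) ∧
      ∫ t, RCLike.re (inner ℂ u (opResSq δ t A u)) = π / δ * ‖u‖ ^ 2 := by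
  obtain ⟨h1, h2⟩ := integrable_and_integral_smul_opResSq (f := fun _ => 1) (m := 1) hδ hA
    continuous_const (by simp)
  simp only [one_smul] at h1 h2
  have h3 : opFun (poissonMean δ fun _ => 1) A = 1 := by
    have : poissonMean δ (fun _ => 1) = fun _ => 1 := by
      ext x
      rw [poissonMean, integral_smul_const, integral_cauchyWeight, one_smul]
    rw [this, opFun_const hA, map_one]
  set Φ : (H →L[ℂ] H) →L[ℂ] ℂ :=
    (innerSL ℂ u).comp (ContinuousLinearMap.apply ℂ H u) with hΦ
  have hΦa : ∀ T, Φ T = inner ℂ u (T u) := fun T => rfl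
  have h4 : ∫ t, inner ℂ u (opResSq δ t A u) = inner ℂ u ((∫ t, opResSq δ t A) u) := by
    simpa only [hΦa] using Φ.integral_comp_comm h1
  have h5 : Integrable fun t => inner ℂ u (opResSq δ t A u) := Φ.integrable_comp h1
  have h6 : ((π / δ : ℝ) : ℂ) • (1 : H →L[ℂ] H) = ∫ t, opResSq δ t A := by
    rw [← h3, h2, smul_smul, ← Complex.ofReal_mul,
      show π / δ * (δ / π) = 1 by field_simp, Complex.ofReal_one, one_smul]
  refine ⟨h5.re, ?_⟩
  rw [integral_re h5, h4, ← h6, smul_apply, one_apply_eq_self, inner_smul_right,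
    inner_self_eq_norm_sq_to_K]
  have : ((π / δ : ℝ) : ℂ) * ((‖u‖ : ℝ) : ℂ) ^ 2 = ((π / δ * ‖u‖ ^ 2 : ℝ) : ℂ) := by push_cast; ring
  exact (congrArg RCLike.re this).trans (RCLike.ofReal_re (K := ℂ) _)

end Resolvent

section TraceEstimate

open MeasureTheory Real

variable {H : Type} [NormedAddCommGroup H] [InnerProductSpace ℂ H]

lemma mul_le_weighted_sq {l : ℝ} (hl : 0 < l) (p q : ℝ) :
    p * q ≤ (l * p ^ 2 + l⁻¹ * q ^ 2) / 2 := by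
  have h : l⁻¹ * (l * p - q) ^ 2 = l * p ^ 2 + l⁻¹ * q ^ 2 - 2 * (p * q) := by
    field_simp
    ring
  have : 0 ≤ l⁻¹ * (l * p - q) ^ 2 := by positivity
  linarith

lemma sum_norm_inner_mul_norm_inner_le {n : ℕ} {x y : Fin n → H} (hx : Orthonormal ℂ x)
    (hy : Orthonormal ℂ y) {l : ℝ} (hl : 0 < l) (u v : H) :
    ∑ i, ‖inner ℂ (y i) u‖ * ‖inner ℂ v (x i)‖ ≤ (l * ‖u‖ ^ 2 + l⁻¹ * ‖v‖ ^ 2) / 2 := by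
  have h1 := hy.sum_inner_products_le u (s := Finset.univ)
  have h2 := hx.sum_inner_products_le v (s := Finset.univ)
  refine (Finset.sum_le_sum fun i _ => mul_le_weighted_sq hl _ _).trans ?_
  rw [← Finset.sum_div, Finset.sum_add_distrib, ← Finset.mul_sum, ← Finset.mul_sum]
  simp_rw [norm_inner_symm v]
  gcongr

variable [CompleteSpace H] {A B : H →L[ℂ] H}

lemma sum_norm_inner_mul_mul_le {n : ℕ} {x y : Fin n → H} (hx : Orthonormal ℂ x)
    (hy : Orthonormal ℂ y) {X Y K : H →L[ℂ] H} (hX : IsSelfAdjoint X) (hY : IsSelfAdjoint Y)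
    {ι : Type} [Fintype ι] {u v : ι → H} {ε : ℝ} (hε : 0 ≤ ε)
    (hK : ‖K - ∑ k, InnerProductSpace.rankOne ℂ (u k) (v k)‖ ≤ ε) {l : ℝ} (hl : 0 < l) :
    ∑ i, ‖inner ℂ (y i) ((X * K * Y) (x i))‖ ≤
      ∑ k, (l * ‖X (u k)‖ ^ 2 + l⁻¹ * ‖Y (v k)‖ ^ 2) / 2 +
        ε * ∑ i, (l * ‖X (y i)‖ ^ 2 + l⁻¹ * ‖Y (x i)‖ ^ 2) / 2 := by
  set E := K - ∑ k, InnerProductSpace.rankOne ℂ (u k) (v k) with hE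
  have hKE : K = ∑ k, InnerProductSpace.rankOne ℂ (u k) (v k) + E := by rw [hE]; abel
  have hterm : ∀ i, ‖inner ℂ (y i) ((X * K * Y) (x i))‖ ≤
      ∑ k, ‖inner ℂ (y i) (X (u k))‖ * ‖inner ℂ (Y (v k)) (x i)‖ +
        ε * ((l * ‖X (y i)‖ ^ 2 + l⁻¹ * ‖Y (x i)‖ ^ 2) / 2) := by
    intro i
    have h1 : inner ℂ (y i) ((X * K * Y) (x i)) =
        ∑ k, inner ℂ (y i) (X (u k)) * inner ℂ (Y (v k)) (x i) +
          inner ℂ (X (y i)) (E (Y (x i))) := by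
      have h2 : inner ℂ (X (y i)) (E (Y (x i))) = inner ℂ (y i) (X (E (Y (x i)))) :=
        hX.isSymmetric _ _
      have h3 : ∀ k, inner ℂ (Y (v k)) (x i) = inner ℂ (v k) (Y (x i)) := fun k =>
        hY.isSymmetric _ _
      rw [h2]
      simp only [h3]
      conv_lhs => rw [mul_apply_eq_comp, mul_apply_eq_comp, hKE, add_apply, sum_apply, map_add,
        map_sum, inner_add_right, inner_sum]
      simp only [InnerProductSpace.rankOne_apply, map_smul, inner_smul_right]
      congr 1
      exact Finset.sum_congr rfl fun k _ => mul_comm _ _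
    rw [h1]
    refine (norm_add_le _ _).trans (add_le_add ?_ ?_)
    · refine (norm_sum_le _ _).trans (Finset.sum_le_sum fun k _ => ?_)
      rw [norm_mul]
    · calc ‖inner ℂ (X (y i)) (E (Y (x i)))‖ ≤ ‖X (y i)‖ * (‖E‖ * ‖Y (x i)‖) :=
          (norm_inner_le_norm _ _).trans (mul_le_mul_of_nonneg_left (E.le_opNorm _)
            (norm_nonneg _))
        _ = ‖E‖ * (‖X (y i)‖ * ‖Y (x i)‖) := by ring
        _ ≤ ε * ((l * ‖X (y i)‖ ^ 2 + l⁻¹ * ‖Y (x i)‖ ^ 2) / 2) :=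
          mul_le_mul hK (mul_le_weighted_sq hl _ _) (by positivity) hε
  refine (Finset.sum_le_sum fun i _ => hterm i).trans ?_
  rw [Finset.sum_add_distrib, Finset.sum_comm, ← Finset.mul_sum]
  gcongr with k
  exact sum_norm_inner_mul_norm_inner_le hx hy hl _ _

lemma sum_norm_inner_opResSq_sub_le {n : ℕ} {x y : Fin n → H} (hx : Orthonormal ℂ x)
    (hy : Orthonormal ℂ y) {δ : ℝ} (hδ : 0 < δ) (hA : IsSelfAdjoint A) (hB : IsSelfAdjoint B)
    {ι : Type} [Fintype ι] {u v : ι → H} {ε : ℝ} (hε : 0 ≤ ε)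
    (hK : ‖A - B - ∑ k, InnerProductSpace.rankOne ℂ (u k) (v k)‖ ≤ ε) (t : ℝ) :
    ∑ i, ‖inner ℂ (y i) ((opResSq δ t A - opResSq δ t B) (x i))‖ ≤
      (2 * δ)⁻¹ * (∑ k, (RCLike.re (inner ℂ (u k) (opResSq δ t A (u k))) +
          RCLike.re (inner ℂ (v k) (opResSq δ t B (v k)))) +
        ε * ∑ i, (RCLike.re (inner ℂ (y i) (opResSq δ t A (y i))) +
          RCLike.re (inner ℂ (x i) (opResSq δ t B (x i))))) := by
  have hS : ∀ T : H →L[ℂ] H, IsSelfAdjoint (opResSq δ t T) := fun T => isSelfAdjoint_opFun _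
  have hR : ∀ T : H →L[ℂ] H, IsSelfAdjoint (opResRe δ t T) := fun T => isSelfAdjoint_opFun _
  have h1 := sum_norm_inner_mul_mul_le hx hy (hR A) (hS B) hε hK (inv_pos.2 hδ)
  have h2 := sum_norm_inner_mul_mul_le hx hy (hS A) (hR B) hε hK hδ
  have h3 : ∑ i, ‖inner ℂ (y i) ((opResSq δ t A - opResSq δ t B) (x i))‖ ≤
      ∑ i, ‖inner ℂ (y i) ((opResRe δ t A * (A - B) * opResSq δ t B) (x i))‖ +
        ∑ i, ‖inner ℂ (y i) ((opResSq δ t A * (A - B) * opResRe δ t B) (x i))‖ := by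
    rw [opResSq_sub_opResSq hδ t hA hB, ← Finset.sum_add_distrib]
    refine Finset.sum_le_sum fun i _ => ?_
    rw [neg_apply, inner_neg_right, norm_neg, add_apply, inner_add_right]
    exact norm_add_le _ _
  refine (h3.trans (add_le_add h1 h2)).trans_eq ?_
  simp only [re_inner_opResSq hδ]
  have key : ∀ p q p' q' : ℝ, (δ⁻¹ * p + δ⁻¹⁻¹ * q) / 2 + (δ * p' + δ⁻¹ * q') / 2 =
      (2 * δ)⁻¹ * (p + δ ^ 2 * p' + (q' + δ ^ 2 * q)) := by
    intro p q p' q'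
    field_simp
    ring
  rw [add_add_add_comm, ← Finset.sum_add_distrib, ← mul_add, ← Finset.sum_add_distrib]
  simp only [key]
  rw [← Finset.mul_sum, ← Finset.mul_sum]
  ring

/-- The Poisson mean at scale `δ` of a bounded function maps trace class perturbations to trace
class perturbations, with constant `O(1 / δ)`. -/
lemma traceBound_opFun_poissonMean {δ : ℝ} (hδ : 0 < δ) (hA : IsSelfAdjoint A)
    (hB : IsSelfAdjoint B) (hK : Summable (sVal (A - B))) {f : ℝ → ℂ} {m : ℝ}
    (hf : Continuous f) (hm : ∀ x, ‖f x‖ ≤ m) :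
    TraceBound (opFun (poissonMean δ f) A - opFun (poissonMean δ f) B)
      (12 * (∑' j, sVal (A - B) j) * m / δ) := by
  intro n x y hx hy
  have hm0 : 0 ≤ m := (norm_nonneg _).trans (hm 0)
  obtain ⟨hIA, hPA⟩ := integrable_and_integral_smul_opResSq hδ hA hf hm
  obtain ⟨hIB, hPB⟩ := integrable_and_integral_smul_opResSq hδ hB hf hm
  have hdiff : opFun (poissonMean δ f) A - opFun (poissonMean δ f) B =
      ((δ / π : ℝ) : ℂ) • ∫ t, f t • (opResSq δ t A - opResSq δ t B) := by
    rw [hPA, hPB, ← smul_sub, ← integral_sub hIA hIB]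
    simp only [smul_sub]
  have hI : Integrable fun t => f t • (opResSq δ t A - opResSq δ t B) := by
    simp only [smul_sub]
    exact hIA.sub hIB
  set F : Fin n → ℝ → ℂ := fun i t =>
    inner ℂ (y i) ((f t • (opResSq δ t A - opResSq δ t B)) (x i)) with hF
  have hFI : ∀ i, Integrable (F i) := fun i =>
    ((innerSL ℂ (y i)).comp (ContinuousLinearMap.apply ℂ H (x i))).integrable_comp hI
  have hFint : ∀ i, ∫ t, F i t =
      inner ℂ (y i) ((∫ t, f t • (opResSq δ t A - opResSq δ t B)) (x i)) := fun i =>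
    ((innerSL ℂ (y i)).comp (ContinuousLinearMap.apply ℂ H (x i))).integral_comp_comm hI
  have hstep : ∑ i, ‖inner ℂ (y i)
      ((opFun (poissonMean δ f) A - opFun (poissonMean δ f) B) (x i))‖ ≤
      δ / π * ∫ t, ∑ i, ‖F i t‖ := by
    rw [integral_finsetSum _ fun i _ => (hFI i).norm, Finset.mul_sum]
    refine Finset.sum_le_sum fun i _ => ?_
    rw [hdiff, smul_apply, inner_smul_right, norm_mul, Complex.norm_real,
      norm_of_nonneg (by positivity), ← hFint i]
    gcongr
    exact norm_integral_le_integral_norm _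
  have hε : ∀ ε : ℝ, 0 < ε → ∑ i, ‖inner ℂ (y i)
      ((opFun (poissonMean δ f) A - opFun (poissonMean δ f) B) (x i))‖ ≤
      12 * (∑' j, sVal (A - B) j) * m / δ + m * (1 + n) / δ * ε := by
    intro ε hε
    obtain ⟨K', ⟨ι, hι, u, v, rfl, huv⟩, hK'⟩ := exists_nuclearBound_norm_sub_le hK hε
    have hGA := fun w => integrable_and_integral_re_inner_opResSq hδ hA w
    have hGB := fun w => integrable_and_integral_re_inner_opResSq hδ hB w
    set E : ℝ → ℝ := fun t => m * ((2 * δ)⁻¹ *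
      (∑ k, (RCLike.re (inner ℂ (u k) (opResSq δ t A (u k))) +
          RCLike.re (inner ℂ (v k) (opResSq δ t B (v k)))) +
        ε * ∑ i, (RCLike.re (inner ℂ (y i) (opResSq δ t A (y i))) +
          RCLike.re (inner ℂ (x i) (opResSq δ t B (x i)))))) with hEdef
    have hk : ∀ k, Integrable fun t => RCLike.re (inner ℂ (u k) (opResSq δ t A (u k))) +
        RCLike.re (inner ℂ (v k) (opResSq δ t B (v k))) := fun k =>
      (hGA (u k)).1.add (hGB (v k)).1
    have hi : ∀ i, Integrable fun t => RCLike.re (inner ℂ (y i) (opResSq δ t A (y i))) +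
        RCLike.re (inner ℂ (x i) (opResSq δ t B (x i))) := fun i =>
      (hGA (y i)).1.add (hGB (x i)).1
    have hS1 : Integrable fun t => ∑ k, (RCLike.re (inner ℂ (u k) (opResSq δ t A (u k))) +
        RCLike.re (inner ℂ (v k) (opResSq δ t B (v k)))) :=
      integrable_finsetSum _ fun k _ => hk k
    have hS2 : Integrable fun t => ε * ∑ i, (RCLike.re (inner ℂ (y i) (opResSq δ t A (y i))) +
        RCLike.re (inner ℂ (x i) (opResSq δ t B (x i)))) :=
      (integrable_finsetSum _ fun i _ => hi i).const_mul ε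
    have hEI : Integrable E := ((hS1.add hS2).const_mul _).const_mul _
    have hEint : ∫ t, E t = m * ((2 * δ)⁻¹ * (π / δ *
        (∑ k, (‖u k‖ ^ 2 + ‖v k‖ ^ 2) + ε * (2 * n)))) := by
      simp only [hEdef]
      rw [integral_const_mul, integral_const_mul, integral_add hS1 hS2, integral_const_mul,
        integral_finsetSum _ fun k _ => hk k,
        integral_finsetSum _ fun i _ => hi i]
      simp_rw [integral_add (hGA _).1 (hGB _).1, (hGA _).2, (hGB _).2, hx.1, hy.1, ← mul_add]
      rw [← Finset.mul_sum]
      simp only [Finset.sum_const, Finset.card_univ, Fintype.card_fin, nsmul_eq_mul]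
      ring
    have hFE : ∫ t, ∑ i, ‖F i t‖ ≤ ∫ t, E t := by
      refine integral_mono (integrable_finsetSum _ fun i _ => (hFI i).norm) hEI fun t => ?_
      have h1 := sum_norm_inner_opResSq_sub_le hx hy hδ hA hB hε.le hK' t
      have h2 : ∀ i, ‖F i t‖ =
          ‖f t‖ * ‖inner ℂ (y i) ((opResSq δ t A - opResSq δ t B) (x i))‖ := by
        intro i
        simp only [hF]
        rw [smul_apply, inner_smul_right, norm_mul]
      simp only [h2, hEdef]
      rw [← Finset.mul_sum]
      exact mul_le_mul (hm t) h1 (Finset.sum_nonneg fun _ _ => norm_nonneg _) hm0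
    calc _ ≤ δ / π * ∫ t, E t := hstep.trans (by gcongr)
      _ = m / (2 * δ) * (∑ k, (‖u k‖ ^ 2 + ‖v k‖ ^ 2) + ε * (2 * n)) := by
        rw [hEint]
        field_simp
      _ ≤ m / (2 * δ) * (2 * (12 * (∑' j, sVal (A - B) j) + ε) + ε * (2 * n)) := by gcongr
      _ = _ := by
        field_simp
        ring
  refine le_of_forall_pos_le_add fun η hη => ?_
  have hc : 0 < m * (1 + n) / δ + 1 := by positivity
  refine (hε (η / (m * (1 + n) / δ + 1)) (by positivity)).trans ?_
  gcongr
  rw [← mul_div_assoc, div_le_iff₀ hc]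
  nlinarith

lemma two_rpow_sub_one_lt_one {α : ℝ} (hα1 : α < 1) : (2 : ℝ) ^ (α - 1) < 1 :=
  rpow_lt_one_of_one_lt_of_neg one_lt_two (by linarith)

lemma integral_cauchyWeight_mul_rpow_nonneg (α : ℝ) : 0 ≤ ∫ s, cauchyWeight s * |s| ^ α :=
  integral_nonneg fun s => mul_nonneg (cauchyWeight_nonneg s) (by positivity)

/-- Poisson means of bounded Hölder functions, with a bound that involves the sup norm only through
a term that tends to zero as `N → ∞`. -/
lemma traceBound_opFun_poissonMean_of_hoelder {α : ℝ} (hα0 : 0 < α) (hα1 : α < 1)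
    (hA : IsSelfAdjoint A) (hB : IsSelfAdjoint B) (hK : Summable (sVal (A - B))) {C m Γ : ℝ}
    (hΓ : 12 * (∑' j, sVal (A - B) j) * (C * (∫ s, cauchyWeight s * |s| ^ α) * 2 ^ α) +
      Γ * 2 ^ (α - 1) ≤ Γ) (N : ℕ) {δ : ℝ} (hδ : 0 < δ)
    {f : ℝ → ℂ} (hm : ∀ x, ‖f x‖ ≤ m) (hC : HoelderWith C α f) :
    TraceBound (opFun (poissonMean δ f) A - opFun (poissonMean δ f) B)
      (Γ * δ ^ (α - 1) + 12 * (∑' j, sVal (A - B) j) * m / (2 ^ N * δ)) := by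
  have hΓ0 : 0 ≤ Γ := by
    have h1 := two_rpow_sub_one_lt_one hα1
    have h2 := hC.nonneg
    have h3 := integral_cauchyWeight_mul_rpow_nonneg α
    have h4 : 0 ≤ ∑' j, sVal (A - B) j := tsum_nonneg fun j => sVal_nonneg _ j
    have h5 : 0 ≤ 12 * (∑' j, sVal (A - B) j) *
      (C * (∫ s, cauchyWeight s * |s| ^ α) * 2 ^ α) := by positivity
    by_contra! hneg
    nlinarith
  induction N generalizing δ f with
  | zero =>
    refine (traceBound_opFun_poissonMean hδ hA hB hK (hC.continuous hα0) hm).mono ?_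
    rw [pow_zero, one_mul]
    exact le_add_of_nonneg_left (by positivity)
  | succ N ih =>
    have h2δ : 0 < 2 * δ := by positivity
    have hf := hC.continuous hα0
    have hC1 : HoelderWith C α (poissonMean δ f) := hC.poissonMean δ hf hm
    have hC2 : HoelderWith C α (poissonMean (2 * δ) f) := hC.poissonMean (2 * δ) hf hm
    have hm1 := norm_poissonMean_le δ hm
    have hm2 := norm_poissonMean_le (2 * δ) hm
    have hg : Continuous fun z => f z - poissonMean (2 * δ) f z := hf.sub (hC2.continuous hα0)
    have hgm := norm_sub_poissonMean_le h2δ hα0 hα1 hf hm hC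
    have hT1 := traceBound_opFun_poissonMean hδ hA hB hK hg hgm
    have hT2 := ih h2δ hm1 hC1
    have hcont1 : Continuous (poissonMean δ fun z => f z - poissonMean (2 * δ) f z) := by
      have h1 : (poissonMean δ fun z => f z - poissonMean (2 * δ) f z) =
          fun z => poissonMean δ f z - poissonMean δ (poissonMean (2 * δ) f) z :=
        funext (poissonMean_sub δ hf hm (hC2.continuous hα0) hm2)
      rw [h1]
      exact (hC1.continuous hα0).sub
        ((hC2.poissonMean δ (hC2.continuous hα0) hm2).continuous hα0)
    have hcont2 : Continuous (poissonMean (2 * δ) (poissonMean δ f)) :=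
      (hC1.poissonMean _ (hC1.continuous hα0) hm1).continuous hα0
    have hsplit : poissonMean δ f = fun z =>
        poissonMean δ (fun z => f z - poissonMean (2 * δ) f z) z +
          poissonMean (2 * δ) (poissonMean δ f) z := by
      ext z
      rw [poissonMean_sub δ hf hm (hC2.continuous hα0) hm2, poissonMean_comm (2 * δ) δ hf hm]
      abel
    rw [hsplit, opFun_add hcont1 hcont2, opFun_add hcont1 hcont2, add_sub_add_comm]
    refine (hT1.add hT2).mono ?_
    have h3 : (2 * δ) ^ (α - 1) = 2 ^ (α - 1) * δ ^ (α - 1) := mul_rpow zero_le_two hδ.le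
    have h4 : (2 * δ) ^ α = 2 ^ α * (δ ^ (α - 1) * δ) := by
      rw [mul_rpow zero_le_two hδ.le, ← rpow_add_one hδ.ne', sub_add_cancel]
    have h5 : (2 : ℝ) ^ N * (2 * δ) = 2 ^ (N + 1) * δ := by ring
    rw [h3, h4, h5, ← add_assoc]
    gcongr
    have h6 := mul_le_mul_of_nonneg_right hΓ (by positivity : 0 ≤ δ ^ (α - 1))
    refine le_trans (le_of_eq ?_) h6
    field_simp

end TraceEstimate

section WeakEstimate

open MeasureTheory Real

lemma MemHoelder.hoelderWith_hoelderNorm {α : ℝ} {f : ℝ → ℂ} (hf : MemHoelder α f) :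
    HoelderWith (hoelderNorm α f) α f := by
  intro x y
  obtain ⟨C, hC0, hC⟩ := hf
  rcases (rpow_nonneg (abs_nonneg (x - y)) α).eq_or_lt with h | h
  · simpa [← h] using hC x y
  · rw [← div_le_iff₀ h]
    exact le_csInf ⟨C, hC0, hC⟩ fun D hD => (div_le_iff₀ h).2 (hD.2 x y)

/-- Truncation of the argument of `f` to `[-R, R]`. -/
def clamp (R : ℝ) (f : ℝ → ℂ) (x : ℝ) : ℂ := f (max (-R) (min x R))

lemma clamp_apply {R x : ℝ} (f : ℝ → ℂ) (hx : |x| ≤ R) : clamp R f x = f x := by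
  rw [abs_le] at hx
  rw [clamp, min_eq_left hx.2, max_eq_right hx.1]

lemma HoelderWith.clamp {C α R : ℝ} {f : ℝ → ℂ} (hα : 0 < α) (hC : HoelderWith C α f) :
    HoelderWith C α (clamp R f) := by
  intro x y
  refine (hC _ _).trans (mul_le_mul_of_nonneg_left (rpow_le_rpow (abs_nonneg _) ?_ hα.le)
    hC.nonneg)
  refine (abs_max_sub_max_le_max _ _ _ _).trans (max_le (by simp) ?_)
  exact (abs_min_sub_min_le_max _ _ _ _).trans (max_le le_rfl (by simp))

lemma exists_norm_clamp_le {f : ℝ → ℂ} (hf : Continuous f) {R : ℝ} (hR : 0 ≤ R) :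
    ∃ m, ∀ x, ‖clamp R f x‖ ≤ m := by
  obtain ⟨m, hm⟩ := (isCompact_Icc (a := -R) (b := R)).exists_bound_of_continuousOn hf.continuousOn
  exact ⟨m, fun x => hm _ ⟨le_max_left _ _, max_le (by linarith) (min_le_right _ _)⟩⟩

variable {H : Type} [NormedAddCommGroup H] [InnerProductSpace ℂ H] [CompleteSpace H]
  {A B : H →L[ℂ] H} {α C : ℝ} {f : ℝ → ℂ}

lemma opFun_clamp {R : ℝ} (f : ℝ → ℂ) (hR : ∀ z ∈ spectrum ℂ A, |z.re| ≤ R) :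
    opFun (clamp R f) A = opFun f A :=
  cfc_congr fun z hz => clamp_apply f (hR z hz)

/-- The constant in the weak type estimate. -/
def weakConst (α : ℝ) : ℝ :=
  (24 * 2 ^ α / (1 - 2 ^ (α - 1)) + 2) * ∫ s, cauchyWeight s * |s| ^ α

lemma weakConst_nonneg (hα1 : α < 1) : 0 ≤ weakConst α := by
  have h1 : 0 < 1 - (2 : ℝ) ^ (α - 1) := sub_pos.2 (two_rpow_sub_one_lt_one hα1)
  have h2 := integral_cauchyWeight_mul_rpow_nonneg α
  unfold weakConst
  positivity

lemma sVal_opFun_sub_le_of_lt_of_bounded (hα0 : 0 < α) (hα1 : α < 1)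
    (hA : IsSelfAdjoint A) (hB : IsSelfAdjoint B) (hK : Summable (sVal (A - B)))
    (hC : HoelderWith C α f) {m : ℝ} (hm : ∀ x, ‖f x‖ ≤ m) {M : ℝ}
    (hM : ∑' j, sVal (A - B) j < M) (j : ℕ) :
    sVal (opFun f A - opFun f B) j ≤ weakConst α * C * (M / (1 + j)) ^ α := by
  set S := ∑' j, sVal (A - B) j with hS
  set κ := ∫ s, cauchyWeight s * |s| ^ α with hκ
  have hS0 : 0 ≤ S := tsum_nonneg fun j => sVal_nonneg _ j
  have hκ0 : 0 ≤ κ := integral_cauchyWeight_mul_rpow_nonneg α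
  have hC0 := hC.nonneg
  have hq : 0 < 1 - (2 : ℝ) ^ (α - 1) := sub_pos.2 (two_rpow_sub_one_lt_one hα1)
  have hM0 : 0 < M := hS0.trans_lt hM
  have hj : (0 : ℝ) < 1 + j := by positivity
  set δ := M / (1 + j) with hδdef
  have hδ : 0 < δ := by positivity
  set Γ := 12 * S * (C * κ * 2 ^ α) / (1 - 2 ^ (α - 1)) with hΓ
  have hΓle : 12 * S * (C * κ * 2 ^ α) + Γ * 2 ^ (α - 1) ≤ Γ := by
    have : Γ * (1 - 2 ^ (α - 1)) = 12 * S * (C * κ * 2 ^ α) := div_mul_cancel₀ _ hq.ne'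
    linarith
  have hT : TraceBound (opFun (poissonMean δ f) A - opFun (poissonMean δ f) B)
      (Γ * δ ^ (α - 1)) := by
    refine TraceBound.of_tendsto
      (fun N => traceBound_opFun_poissonMean_of_hoelder hα0 hα1 hA hB hK hΓle N hδ hm hC) ?_
    have h1 : Filter.Tendsto (fun N : ℕ => (2 : ℝ) ^ N * δ) Filter.atTop Filter.atTop :=
      (tendsto_pow_atTop_atTop_of_one_lt one_lt_two).atTop_mul_const hδ
    simpa using (h1.const_div_atTop (12 * S * m)).const_add (Γ * δ ^ (α - 1))
  have hf := hC.continuous hα0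
  have hP := (hC.poissonMean δ hf hm).continuous hα0
  have hN : ∀ T : H →L[ℂ] H, ‖opFun f T - opFun (poissonMean δ f) T‖ ≤ C * κ * δ ^ α := by
    intro T
    rw [← opFun_sub hf hP]
    exact norm_opFun_le (by positivity) (norm_sub_poissonMean_le hδ hα0 hα1 hf hm hC)
  have h1 : ‖opFun f A - opFun f B - (opFun (poissonMean δ f) A - opFun (poissonMean δ f) B)‖ ≤
      C * κ * δ ^ α + C * κ * δ ^ α := by
    rw [sub_sub_sub_comm]
    exact (norm_sub_le _ _).trans (add_le_add (hN A) (hN B))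
  have h2 : 2 * (Γ * δ ^ (α - 1)) / (1 + j) ≤
      24 * (C * κ * 2 ^ α) / (1 - 2 ^ (α - 1)) * δ ^ α := by
    have h3 : δ ^ α = δ ^ (α - 1) * (M / (1 + j)) := by
      rw [← hδdef, ← rpow_add_one hδ.ne', sub_add_cancel]
    have h4 : Γ ≤ 12 * M * (C * κ * 2 ^ α) / (1 - 2 ^ (α - 1)) := by
      rw [hΓ]
      gcongr
    rw [h3]
    calc 2 * (Γ * δ ^ (α - 1)) / (1 + j)
        ≤ 2 * (12 * M * (C * κ * 2 ^ α) / (1 - 2 ^ (α - 1)) * δ ^ (α - 1)) / (1 + j) := by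
          gcongr
      _ = _ := by ring
  calc sVal (opFun f A - opFun f B) j
      ≤ 24 * (C * κ * 2 ^ α) / (1 - 2 ^ (α - 1)) * δ ^ α + (C * κ * δ ^ α + C * κ * δ ^ α) :=
        (sVal_le_add_norm_sub _ _ j).trans (add_le_add ((hT.sVal_le j).trans h2) h1)
    _ = weakConst α * C * δ ^ α := by
        rw [weakConst, ← hκ]
        ring

lemma sVal_opFun_sub_le (hα0 : 0 < α) (hα1 : α < 1) (hA : IsSelfAdjoint A)
    (hB : IsSelfAdjoint B) (hK : Summable (sVal (A - B))) (hC : HoelderWith C α f) (j : ℕ) :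
    sVal (opFun f A - opFun f B) j ≤
      weakConst α * C * ((∑' j, sVal (A - B) j) / (1 + j)) ^ α := by
  obtain ⟨r, hr0, hr⟩ := exists_abs_re_le_of_mem_spectrum A
  obtain ⟨s, -, hs⟩ := exists_abs_re_le_of_mem_spectrum B
  obtain ⟨m, hm⟩ := exists_norm_clamp_le (hC.continuous hα0) (hr0.trans (le_max_left r s))
  rw [← opFun_clamp f fun z hz => (hr z hz).trans (le_max_left r s),
    ← opFun_clamp f fun z hz => (hs z hz).trans (le_max_right r s)]
  have hcont : Continuous fun M : ℝ => weakConst α * C * (M / (1 + j)) ^ α :=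
    continuous_const.mul ((continuous_id.div_const _).rpow_const fun _ => Or.inr hα0.le)
  refine ge_of_tendsto (hcont.continuousWithinAt (s := Set.Ioi (∑' j, sVal (A - B) j))) ?_
  filter_upwards [self_mem_nhdsWithin] with M hM
  exact sVal_opFun_sub_le_of_lt_of_bounded hα0 hα1 hA hB hK (hC.clamp hα0) hm hM j

end WeakEstimate

theorem stmt1 (α : ℝ) (hα0 : 0 < α) (hα1 : α < 1) :
    ∃ c : ℝ, 0 < c ∧
      ∀ (H : Type) [NormedAddCommGroup H] [InnerProductSpace ℂ H] [CompleteSpace H]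
        [TopologicalSpace.SeparableSpace H],
        ∀ f : ℝ → ℂ, MemHoelder α f →
        ∀ A B : H →L[ℂ] H, IsSelfAdjoint A → IsSelfAdjoint B →
          MemSchatten 1 (A - B) →
            MemWeakSchatten (1 / α) (opFun f A - opFun f B) ∧
            wkNorm (1 / α) (opFun f A - opFun f B) ≤
              c * hoelderNorm α f * schNorm 1 (A - B) ^ α := by
  have hw := weakConst_nonneg hα1
  refine ⟨weakConst α + 1, by positivity, ?_⟩
  intro H _ _ _ _ f hf A B hA hB hK
  have hC := hf.hoelderWith_hoelderNorm
  have hC0 := hC.nonneg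
  simp only [MemSchatten, Real.rpow_one] at hK
  have hsch : schNorm 1 (A - B) = ∑' j, sVal (A - B) j := by simp [schNorm]
  set S := ∑' j, sVal (A - B) j
  have hS0 : 0 ≤ S := tsum_nonneg fun j => sVal_nonneg _ j
  have hbound : ∀ j : ℕ, (1 + (j : ℝ)) * sVal (opFun f A - opFun f B) j ^ (1 / α) ≤
      (weakConst α * hoelderNorm α f) ^ (1 / α) * S := by
    intro j
    have hj : (0 : ℝ) < 1 + j := by positivity
    have h1 := Real.rpow_le_rpow (sVal_nonneg _ _) (sVal_opFun_sub_le hα0 hα1 hA hB hK hC j)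
      (one_div_nonneg.2 hα0.le)
    rw [Real.mul_rpow (by positivity) (by positivity), ← Real.rpow_mul (by positivity),
      mul_one_div_cancel hα0.ne', Real.rpow_one] at h1
    calc (1 + (j : ℝ)) * sVal (opFun f A - opFun f B) j ^ (1 / α)
        ≤ (1 + j) * ((weakConst α * hoelderNorm α f) ^ (1 / α) * (S / (1 + j))) := by gcongr
      _ = _ := by field_simp
  refine ⟨⟨_, hbound⟩, ?_⟩
  rw [wkNorm, hsch, one_div_one_div]
  calc (⨆ j : ℕ, (1 + (j : ℝ)) * sVal (opFun f A - opFun f B) j ^ (1 / α)) ^ α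
      ≤ ((weakConst α * hoelderNorm α f) ^ (1 / α) * S) ^ α :=
        Real.rpow_le_rpow (Real.iSup_nonneg fun j => mul_nonneg (by positivity)
          (Real.rpow_nonneg (sVal_nonneg _ _) _)) (ciSup_le hbound) hα0.le
    _ = weakConst α * hoelderNorm α f * S ^ α := by
        rw [Real.mul_rpow (by positivity) hS0, ← Real.rpow_mul (by positivity),
          one_div_mul_cancel hα0.ne', Real.rpow_one]
    _ ≤ (weakConst α + 1) * hoelderNorm α f * S ^ α := by
        gcongr
        linarith
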